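/- Equivalent form of the space-time bilinear form (Lemma 4.1): if v and w are smooth on the closure of Ω×(0,T), vanish on ∂Ω × [0,T] together with their time derivatives, and satisfy v(·,0) = w(·,0) = 0 on Ω, then A(v,w) = ∫₀ᵀ∫_Ω ∂_t v ∂_t w dx dt + ∫₀ᵀ∫_Ω Δv Δw dx dt + ∫_Ω ∇v(x,T) · ∇w(x,T) dx. -/

import Mathlib

open MeasureTheory

/-- Partial derivative in the `k`-th spatial direction. -/
noncomputable def pdx {d : ℕ} (k : Fin d) (u : (Fin d → ℝ) → ℝ) (x : Fin d → ℝ) : ℝ :=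
  fderiv ℝ u x (Pi.single k 1)

/-- Spatial Laplacian. -/
noncomputable def lapx {d : ℕ} (u : (Fin d → ℝ) → ℝ) (x : Fin d → ℝ) : ℝ :=
  ∑ k : Fin d, pdx k (pdx k u) x

/-- Time derivative. -/
noncomputable def pdt {d : ℕ} (v : (Fin d → ℝ) → ℝ → ℝ) (x : Fin d → ℝ) (t : ℝ) : ℝ :=
  deriv (v x) t

/-- The space-time least-squares bilinear form `A`. -/
noncomputable def Abil {d : ℕ} (Ω : Set (Fin d → ℝ)) (T : ℝ)
    (v w : (Fin d → ℝ) → ℝ → ℝ) : ℝ :=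
  ∫ t in Set.Ioo (0:ℝ) T, ∫ x in Ω,
    (pdt v x t * pdt w x t + lapx (fun y => v y t) x * lapx (fun y => w y t) x
      - pdt v x t * lapx (fun y => w y t) x - lapx (fun y => v y t) x * pdt w x t)





theorem IsPreconnected.inter_frontier_nonempty_of_mem {X : Type*} [TopologicalSpace X]
    {s Ω : Set X} (hs : IsPreconnected s) {x y : X} (hxs : x ∈ s) (hx : x ∈ Ω) (hys : y ∈ s)
    (hy : y ∉ Ω) : (s ∩ frontier Ω).Nonempty := by
  by_contra! hne
  have hnf : ∀ z ∈ s, z ∉ frontier Ω := fun z hz hzf => (hne ▸ ⟨hz, hzf⟩ : z ∈ (∅ : Set X))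
  have hxi : x ∈ interior Ω := by_contra fun hn => hnf x hxs ⟨subset_closure hx, hn⟩
  have hyc : y ∉ closure Ω := fun hc => hnf y hys ⟨hc, fun hi => hy (interior_subset hi)⟩
  obtain ⟨z, -, hzi, hzc⟩ := hs (interior Ω) (closure Ω)ᶜ isOpen_interior
    isClosed_closure.isOpen_compl
    (fun z hz => or_iff_not_imp_right.2 fun hc =>
      by_contra fun hn => hnf z hz ⟨not_not.1 hc, hn⟩) ⟨x, hxs, hxi⟩ ⟨y, hys, hyc⟩
  exact hzc (subset_closure (interior_subset hzi))

theorem LipschitzWith.indicator_of_frontier {E : Type*} [NormedAddCommGroup E] [NormedSpace ℝ E]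
    {Ω : Set E} {h : E → ℝ} {C : NNReal} (hC : LipschitzOnWith C h (closure Ω))
    (h0 : ∀ x ∈ frontier Ω, h x = 0) : LipschitzWith C (Ω.indicator h) := by
  have key : ∀ x ∈ Ω, ∀ y ∉ Ω, |h x| ≤ C * dist x y := by
    intro x hx y hy
    obtain ⟨z, hz, hzf⟩ : (segment ℝ x y ∩ frontier Ω).Nonempty :=
      (convex_segment x y).isPreconnected.inter_frontier_nonempty_of_mem
        (left_mem_segment ℝ x y) hx (right_mem_segment ℝ x y) hy
    have h1 := hC.dist_le_mul x (subset_closure hx) z (frontier_subset_closure hzf)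
    rw [h0 z hzf, Real.dist_0_eq_abs] at h1
    have h2 := dist_add_dist_of_mem_segment hz
    have h3 : dist x z ≤ dist x y := by linarith [dist_nonneg (x := z) (y := y)]
    exact h1.trans (by gcongr)
  refine LipschitzWith.of_dist_le_mul fun x y => ?_
  by_cases hx : x ∈ Ω <;> by_cases hy : y ∈ Ω
  · simpa [hx, hy] using hC.dist_le_mul x (subset_closure hx) y (subset_closure hy)
  · simpa [hx, hy] using key x hx y hy
  · simpa [hx, hy, dist_comm] using key y hy x hx
  · simp [hx, hy]; positivity

theorem DifferentiableAt.lineDeriv_eq_zero_of_abs {E : Type*} [NormedAddCommGroup E] [NormedSpace ℝ E]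
    {f : E → ℝ} {x : E} (hf : DifferentiableAt ℝ (fun y => |f y|) x) (hx : f x = 0) (v : E) :
    lineDeriv ℝ f x v = 0 := by
  have hmin : IsLocalMin (fun y => |f y|) x := Filter.Eventually.of_forall fun y => by simp [hx]
  have h1 := hf.hasFDerivAt
  rw [hmin.fderiv_eq_zero] at h1
  have h2 : HasFDerivAt f (0 : E →L[ℝ] ℝ) x := by
    rw [hasFDerivAt_iff_isLittleO] at h1 ⊢
    simpa [hx, Asymptotics.isLittleO_abs_left] using h1
  simp [h2.hasLineDerivAt v |>.lineDeriv]

theorem setIntegral_fderiv_eq_zero {E : Type*} [NormedAddCommGroup E] [NormedSpace ℝ E]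
    [FiniteDimensional ℝ E] [MeasurableSpace E] [BorelSpace E] (μ : Measure E) [μ.IsAddHaarMeasure]
    {Ω : Set E} (hΩo : IsOpen Ω) (hΩb : Bornology.IsBounded Ω) {h : E → ℝ}
    (hh : ContDiff ℝ 1 h) (h0 : ∀ x ∈ frontier Ω, h x = 0) (v : E) :
    ∫ x in Ω, fderiv ℝ h x v ∂μ = 0 := by
  obtain ⟨R, hR⟩ := hΩb.closure.subset_closedBall 0
  obtain ⟨C, hC⟩ := hh.contDiffOn.exists_lipschitzOnWith one_ne_zero
    (convex_closedBall (0 : E) R) (isCompact_closedBall 0 R)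
  have hL : LipschitzWith C (Ω.indicator h) :=
    LipschitzWith.indicator_of_frontier (hC.mono hR) h0
  have hcs : HasCompactSupport (Ω.indicator h) :=
    HasCompactSupport.of_support_subset_isCompact (isCompact_closedBall 0 R)
      (Set.support_indicator_subset.trans (subset_closure.trans hR))
  have h1 := LipschitzWith.integral_lineDeriv_mul_eq (μ := μ)
    (LipschitzWith.const (1 : ℝ)) hL hcs (-v)
  simp only [lineDeriv, deriv_const, zero_mul, integral_zero, neg_neg, mul_one] at h1
  have hae : (fun x => lineDeriv ℝ (Ω.indicator h) x v) =ᵐ[μ] Ω.indicator fun x => fderiv ℝ h x v := by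
    have habs : LipschitzWith C fun y => |Ω.indicator h y| := by
      simpa [Function.comp_def] using LipschitzWith.comp lipschitzWith_one_norm hL
    filter_upwards [habs.ae_differentiableAt (μ := μ)] with x hx
    by_cases hxΩ : x ∈ Ω
    · have he : Ω.indicator h =ᶠ[nhds x] h := by
        filter_upwards [hΩo.mem_nhds hxΩ] with y hy using by simp [hy]
      rw [he.lineDeriv_eq, Set.indicator_of_mem hxΩ]
      exact (hh.differentiable one_ne_zero x).lineDeriv_eq_fderiv
    · rw [Set.indicator_of_notMem hxΩ]
      exact hx.lineDeriv_eq_zero_of_abs (by simp [hxΩ]) v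
  rw [← integral_indicator hΩo.measurableSet, ← integral_congr_ae hae]
  exact h1.symm

/-- The derivative of `U` in the direction `e`, as a function of the base point. -/
noncomputable def dirDeriv {E : Type*} [NormedAddCommGroup E] [NormedSpace ℝ E] (e : E)
    (U : E → ℝ) (p : E) : ℝ :=
  fderiv ℝ U p e

section dirDeriv

variable {E : Type*} [NormedAddCommGroup E] [NormedSpace ℝ E]

theorem contDiff_dirDeriv {U : E → ℝ} (hU : ContDiff ℝ (⊤ : ℕ∞) U) (e : E) :
    ContDiff ℝ (⊤ : ℕ∞) (dirDeriv e U) :=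
  (hU.fderiv_right (m := (⊤ : ℕ∞)) (by simp)).clm_apply contDiff_const

theorem dirDeriv_comm {U : E → ℝ} (hU : ContDiff ℝ (⊤ : ℕ∞) U) (a b : E) :
    dirDeriv a (dirDeriv b U) = dirDeriv b (dirDeriv a U) := by
  have hd : Differentiable ℝ (fderiv ℝ U) :=
    (hU.fderiv_right (m := (⊤ : ℕ∞)) (by simp)).differentiable (by simp)
  have key : ∀ (a b p : E), dirDeriv a (dirDeriv b U) p = fderiv ℝ (fderiv ℝ U) p a b := by
    intro a b p
    have h : HasFDerivAt (dirDeriv b U) _ p := (hd p).hasFDerivAt.clm_apply (hasFDerivAt_const b p)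
    rw [dirDeriv, h.fderiv]
    simp
  ext p
  have hsymm : IsSymmSndFDerivAt ℝ U p := hU.contDiffAt.isSymmSndFDerivAt (by
    rw [minSmoothness_of_isRCLikeNormedField]; exact WithTop.coe_le_coe.2 le_top)
  rw [key, key, hsymm.eq]

theorem dirDeriv_add {U V : E → ℝ} (hU : Differentiable ℝ U) (hV : Differentiable ℝ V) (e p : E) :
    dirDeriv e (fun q => U q + V q) p = dirDeriv e U p + dirDeriv e V p := by
  rw [dirDeriv, fderiv_fun_add (hU p) (hV p)]
  rfl

theorem dirDeriv_mul {U V : E → ℝ} (hU : Differentiable ℝ U) (hV : Differentiable ℝ V) (e p : E) :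
    dirDeriv e (fun q => U q * V q) p = dirDeriv e U p * V p + U p * dirDeriv e V p := by
  rw [dirDeriv, fderiv_fun_mul (hU p) (hV p)]
  simp [dirDeriv]
  ring

theorem fderiv_slice_left {U : E × ℝ → ℝ} (hU : Differentiable ℝ U) (e x : E) (t : ℝ) :
    fderiv ℝ (fun y => U (y, t)) x e = dirDeriv (e, (0 : ℝ)) U (x, t) := by
  have h : HasFDerivAt (fun y => U (y, t)) _ x :=
    (hU (x, t)).hasFDerivAt.comp x (hasFDerivAt_prodMk_left x t)
  rw [h.fderiv]
  simp [dirDeriv]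

theorem hasDerivAt_slice_right {U : E × ℝ → ℝ} (hU : Differentiable ℝ U) (x : E) (t : ℝ) :
    HasDerivAt (fun s => U (x, s)) (dirDeriv ((0 : E), (1 : ℝ)) U (x, t)) t := by
  have h : HasFDerivAt (fun s => U (x, s)) _ t :=
    (hU (x, t)).hasFDerivAt.comp t (hasFDerivAt_prodMk_right x t)
  simpa [dirDeriv] using h.hasDerivAt

theorem dirDeriv_eq_zero_of_slice_eq_zero {Ω : Set E} (hΩ : IsOpen Ω) {U : E × ℝ → ℝ}
    (hU : Differentiable ℝ U) {t : ℝ} (h0 : ∀ x ∈ Ω, U (x, t) = 0) (e : E) {x : E} (hx : x ∈ Ω) :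
    dirDeriv (e, (0 : ℝ)) U (x, t) = 0 := by
  have he : (fun y => U (y, t)) =ᶠ[nhds x] fun _ => 0 := by
    filter_upwards [hΩ.mem_nhds hx] with y hy using h0 y hy
  rw [← fderiv_slice_left hU, he.fderiv_eq]
  simp

theorem setIntegral_dirDeriv_eq_zero [FiniteDimensional ℝ E] [MeasurableSpace E] [BorelSpace E]
    (μ : Measure E) [μ.IsAddHaarMeasure] {Ω : Set E} (hΩo : IsOpen Ω) (hΩb : Bornology.IsBounded Ω)
    {U : E × ℝ → ℝ} (hU : ContDiff ℝ (⊤ : ℕ∞) U) {t : ℝ} (h0 : ∀ x ∈ frontier Ω, U (x, t) = 0)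
    (e : E) : ∫ x in Ω, dirDeriv (e, (0 : ℝ)) U (x, t) ∂μ = 0 := by
  have hd : Differentiable ℝ U := hU.differentiable (by simp)
  have hs : ContDiff ℝ 1 fun y => U (y, t) :=
    (hU.of_le (by norm_cast)).comp (contDiff_id.prodMk contDiff_const)
  simpa only [fderiv_slice_left hd] using setIntegral_fderiv_eq_zero μ hΩo hΩb hs h0 e

end dirDeriv

theorem Continuous.integrableOn_of_isBounded {E : Type*} [NormedAddCommGroup E] [NormedSpace ℝ E]
    [FiniteDimensional ℝ E] [MeasurableSpace E] [BorelSpace E] {μ : Measure E}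
    [IsFiniteMeasureOnCompacts μ] {Ω : Set E} (hΩ : Bornology.IsBounded Ω) {f : E → ℝ}
    (hf : Continuous f) : IntegrableOn f Ω μ :=
  (hf.continuousOn.integrableOn_compact hΩ.isCompact_closure).mono_set subset_closure

theorem pdx_slice {d : ℕ} {U : (Fin d → ℝ) × ℝ → ℝ} (hU : Differentiable ℝ U) (k : Fin d) (t : ℝ) :
    pdx k (fun y => U (y, t)) = fun x => dirDeriv (Pi.single k 1, (0 : ℝ)) U (x, t) :=
  funext fun x => fderiv_slice_left hU _ x t

theorem lapx_slice {d : ℕ} {U : (Fin d → ℝ) × ℝ → ℝ} (hU : ContDiff ℝ (⊤ : ℕ∞) U) (x : Fin d → ℝ)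
    (t : ℝ) : lapx (fun y => U (y, t)) x = ∑ k : Fin d,
      dirDeriv (Pi.single k 1, (0 : ℝ)) (dirDeriv (Pi.single k 1, (0 : ℝ)) U) (x, t) := by
  refine Finset.sum_congr rfl fun k _ => ?_
  rw [pdx_slice (hU.differentiable (by simp)),
    pdx_slice ((contDiff_dirDeriv hU _).differentiable (by simp))]

/-- Lemma 4.1 (equivalent form of the space-time bilinear form): if `v, w` are smooth,
vanish (together with their time derivatives) on `∂Ω × [0,T]` and vanish at `t = 0`, then
`A(v,w) = ∫₀ᵀ∫_Ω ∂ₜv ∂ₜw + ∫₀ᵀ∫_Ω Δv Δw + ∫_Ω ∇v(x,T)·∇w(x,T)`. -/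
theorem equivalent_form_of_spacetime_bilinear_form
    {d : ℕ} (Ω : Set (Fin d → ℝ)) (hΩo : IsOpen Ω) (hΩb : Bornology.IsBounded Ω)
    (T : ℝ) (hT : 0 < T) (v w : (Fin d → ℝ) → ℝ → ℝ)
    (hv : ContDiff ℝ (⊤ : ℕ∞) (Function.uncurry v))
    (hw : ContDiff ℝ (⊤ : ℕ∞) (Function.uncurry w))
    (hbcv : ∀ x ∈ frontier Ω, ∀ t ∈ Set.Icc (0:ℝ) T, v x t = 0)
    (hbcw : ∀ x ∈ frontier Ω, ∀ t ∈ Set.Icc (0:ℝ) T, w x t = 0)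
    (hbcvt : ∀ x ∈ frontier Ω, ∀ t ∈ Set.Icc (0:ℝ) T, pdt v x t = 0)
    (hbcwt : ∀ x ∈ frontier Ω, ∀ t ∈ Set.Icc (0:ℝ) T, pdt w x t = 0)
    (hicv : ∀ x ∈ Ω, v x 0 = 0) (hicw : ∀ x ∈ Ω, w x 0 = 0) :
    Abil Ω T v w
      = (∫ t in Set.Ioo (0:ℝ) T, ∫ x in Ω, pdt v x t * pdt w x t)
        + (∫ t in Set.Ioo (0:ℝ) T, ∫ x in Ω,
            lapx (fun y => v y t) x * lapx (fun y => w y t) x)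
        + ∫ x in Ω, ∑ k : Fin d, pdx k (fun y => v y T) x * pdx k (fun y => w y T) x := by
  have hvd := hv.differentiable (by simp)
  have hwd := hw.differentiable (by simp)
  set V := Function.uncurry v
  set W := Function.uncurry w
  let e : Fin d → (Fin d → ℝ) × ℝ := fun k => (Pi.single k 1, 0)
  let τ : (Fin d → ℝ) × ℝ := (0, 1)
  let L : ((Fin d → ℝ) × ℝ → ℝ) → (Fin d → ℝ) × ℝ → ℝ := fun U p =>
    ∑ k, dirDeriv (e k) (dirDeriv (e k) U) p
  have hDv := contDiff_dirDeriv hv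
  have hDw := contDiff_dirDeriv hw
  have hDdv := fun a => (hDv a).differentiable (by simp)
  have hDdw := fun a => (hDw a).differentiable (by simp)
  have hc1 := fun a => (hDv a).continuous
  have hc2 := fun a => (hDw a).continuous
  have hc3 := fun a b => (contDiff_dirDeriv (hDv a) b).continuous
  have hc4 := fun a b => (contDiff_dirDeriv (hDw a) b).continuous
  have hpv : ∀ x t, pdt v x t = dirDeriv τ V (x, t) := fun x t =>
    (hasDerivAt_slice_right hvd x t).deriv
  have hpw : ∀ x t, pdt w x t = dirDeriv τ W (x, t) := fun x t =>
    (hasDerivAt_slice_right hwd x t).deriv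
  have hlv : ∀ x t, lapx (fun y => v y t) x = L V (x, t) := fun x t => lapx_slice hv x t
  have hlw : ∀ x t, lapx (fun y => w y t) x = L W (x, t) := fun x t => lapx_slice hw x t
  have hxv : ∀ k x t, pdx k (fun y => v y t) x = dirDeriv (e k) V (x, t) := fun k x t =>
    congrFun (pdx_slice hvd k t) x
  have hxw : ∀ k x t, pdx k (fun y => w y t) x = dirDeriv (e k) W (x, t) := fun k x t =>
    congrFun (pdx_slice hwd k t) x
  simp only [hpv, hpw] at hbcvt hbcwt
  simp only [Abil, hpv, hpw, hlv, hlw, hxv, hxw]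
  have hLv : Continuous (L V) := continuous_finsetSum _ fun k _ => hc3 _ _
  have hLw : Continuous (L W) := continuous_finsetSum _ fun k _ => hc4 _ _
  have hslice : ∀ {F : (Fin d → ℝ) × ℝ → ℝ}, Continuous F → ∀ t,
      Integrable (fun x => F (x, t)) (volume.restrict Ω) := fun hF t =>
    Continuous.integrableOn_of_isBounded hΩb (by fun_prop)
  have hprod : ∀ {F : (Fin d → ℝ) × ℝ → ℝ}, Continuous F →
      Integrable (fun p : ℝ × (Fin d → ℝ) => F (p.2, p.1))
        ((volume.restrict (Set.Ioo 0 T)).prod (volume.restrict Ω)) := fun {F} hF => by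
    rw [Measure.prod_restrict]
    exact Continuous.integrableOn_of_isBounded ((Metric.isBounded_Ioo 0 T).prod hΩb)
      (by fun_prop)
  let G : (Fin d → ℝ) × ℝ → ℝ := fun p => ∑ k, dirDeriv (e k) V p * dirDeriv (e k) W p
  let G' : (Fin d → ℝ) × ℝ → ℝ := fun p => ∑ k, (dirDeriv τ (dirDeriv (e k) V) p *
    dirDeriv (e k) W p + dirDeriv (e k) V p * dirDeriv τ (dirDeriv (e k) W) p)
  have hG' : Continuous G' := by fun_prop
  have hGderiv : ∀ x t, HasDerivAt (fun s => G (x, s)) (G' (x, t)) t := fun x t =>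
    HasDerivAt.fun_sum fun k _ =>
      (hasDerivAt_slice_right (hDdv _) x t).mul (hasDerivAt_slice_right (hDdw _) x t)
  have hGzero : ∀ x ∈ Ω, G (x, 0) = 0 := fun x hx => Finset.sum_eq_zero fun k _ => by
    rw [dirDeriv_eq_zero_of_slice_eq_zero hΩo hvd hicv _ hx, zero_mul]
  have hFTC : ∀ x ∈ Ω, ∫ t in Set.Ioo 0 T, G' (x, t) = G (x, T) := fun x hx => by
    rw [← integral_Ioc_eq_integral_Ioo, ← intervalIntegral.integral_of_le hT.le,
      intervalIntegral.integral_eq_sub_of_hasDerivAt (fun t _ => hGderiv x t)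
        (Continuous.intervalIntegrable (by fun_prop) _ _), hGzero x hx, sub_zero]
  have hswap : ∫ t in Set.Ioo 0 T, ∫ x in Ω, G' (x, t) = ∫ x in Ω, G (x, T) :=
    (integral_integral_swap (f := fun t x => G' (x, t)) (hprod hG')).trans
      (setIntegral_congr_fun hΩo.measurableSet hFTC)
  let H : Fin d → (Fin d → ℝ) × ℝ → ℝ := fun k p =>
    dirDeriv τ V p * dirDeriv (e k) W p + dirDeriv (e k) V p * dirDeriv τ W p
  have hH : ∀ k, ContDiff ℝ (⊤ : ℕ∞) (H k) := fun k =>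
    ((hDv _).mul (hDw _)).add ((hDv _).mul (hDw _))
  have hA : Continuous fun p => dirDeriv τ V p * dirDeriv τ W p := by fun_prop
  have hB : Continuous fun p => L V p * L W p := by fun_prop
  have hC : Continuous fun p => dirDeriv τ V p * L W p + L V p * dirDeriv τ W p + G' p := by
    fun_prop
  have hGreen : ∀ t ∈ Set.Ioo 0 T, ∫ x in Ω, (dirDeriv τ V (x, t) * L W (x, t)
      + L V (x, t) * dirDeriv τ W (x, t) + G' (x, t)) = 0 := fun t ht => by
    have hdiv : ∀ k, ∫ x in Ω, dirDeriv (e k) (H k) (x, t) = 0 := fun k =>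
      setIntegral_dirDeriv_eq_zero volume hΩo hΩb (hH k) (fun x hx => by
        simp [H, hbcvt x hx t (Set.Ioo_subset_Icc_self ht),
          hbcwt x hx t (Set.Ioo_subset_Icc_self ht)]) _
    have hsum := integral_finsetSum Finset.univ (fun k _ =>
      hslice (contDiff_dirDeriv (hH k) (e k)).continuous t)
    rw [Finset.sum_eq_zero fun k _ => hdiv k] at hsum
    rw [← hsum]
    refine integral_congr_ae (.of_forall fun x => ?_)
    simp only [L, G', Finset.mul_sum, Finset.sum_mul, ← Finset.sum_add_distrib]
    refine Finset.sum_congr rfl fun k _ => ?_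
    have hadd : dirDeriv (e k) (H k) (x, t)
        = dirDeriv (e k) (fun q => dirDeriv τ V q * dirDeriv (e k) W q) (x, t)
          + dirDeriv (e k) (fun q => dirDeriv (e k) V q * dirDeriv τ W q) (x, t) :=
      dirDeriv_add ((hDdv _).fun_mul (hDdw _)) ((hDdv _).fun_mul (hDdw _)) _ _
    rw [hadd, dirDeriv_mul (hDdv _) (hDdw _), dirDeriv_mul (hDdv _) (hDdw _),
      dirDeriv_comm hv τ, dirDeriv_comm hw τ]
    ring
  have hpt : ∀ t ∈ Set.Ioo 0 T, ∫ x in Ω, (dirDeriv τ V (x, t) * dirDeriv τ W (x, t)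
      + L V (x, t) * L W (x, t) - dirDeriv τ V (x, t) * L W (x, t)
      - L V (x, t) * dirDeriv τ W (x, t)) = (∫ x in Ω, dirDeriv τ V (x, t) * dirDeriv τ W (x, t))
      + (∫ x in Ω, L V (x, t) * L W (x, t)) + ∫ x in Ω, G' (x, t) := fun t ht => by
    have i1 := hslice hA t
    have i2 := hslice hB t
    have i3 := hslice hG' t
    have i4 := hslice hC t
    have hsub := integral_sub ((i1.fun_add i2).fun_add i3) i4
    rw [hGreen t ht, sub_zero] at hsub
    rw [← integral_add i1 i2, ← integral_add (i1.fun_add i2) i3, ← hsub]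
    exact integral_congr_ae (.of_forall fun x => by ring)
  rw [setIntegral_congr_fun measurableSet_Ioo hpt, ← hswap]
  have j1 := (hprod hA).integral_prod_left
  have j2 := (hprod hB).integral_prod_left
  have j3 := (hprod hG').integral_prod_left
  rw [← integral_add j1 j2, ← integral_add (j1.fun_add j2) j3]
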